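/- Let θ : ℝ → ℝ be differentiable at 0 with θ(0) = 0 and derivative θ'(0). For t < 0 let I_t be the 4×4 real matrix equal to the identity except that its lower-right 2×2 block (rows and columns indexed 2 and 3) is [[cosh θ(t), sinh θ(t)], [sinh θ(t), cosh θ(t)]]. Then, as t → 0⁻, the conjugated matrices τ_t · I_t · τ_t⁻¹ converge to the 4×4 matrix equal to the identity except that its (3,2) entry is −θ'(0). -/

import Mathlib

open Matrix Filter Topology Real

/-- The projective rescaling `τ_t = diag(1,1,1,1/|t|)`. -/
noncomputable def tauRescale (t : ℝ) : Matrix (Fin 4) (Fin 4) ℝ :=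
  Matrix.diagonal ![1, 1, 1, 1 / |t|]

theorem tauRescale_inv {t : ℝ} (ht : t ≠ 0) :
    (tauRescale t)⁻¹ = Matrix.diagonal ![1, 1, 1, |t|] := by
  refine Matrix.inv_eq_right_inv ?_
  rw [tauRescale, Matrix.diagonal_mul_diagonal, ← Matrix.diagonal_one]
  congr 1
  ext i
  fin_cases i <;> simp [ht]

/-- For `t < 0`, conjugation by `τ_t` divides the `(3,2)` entry of a matrix acting on the last two
coordinates by `-t` and multiplies its `(2,3)` entry by `-t`. -/
theorem tauRescale_conj_of_neg {t : ℝ} (ht : t < 0) (a b c d : ℝ) :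
    tauRescale t * !![1, 0, 0, 0; 0, 1, 0, 0; 0, 0, a, b; 0, 0, c, d] * (tauRescale t)⁻¹ =
      !![1, 0, 0, 0; 0, 1, 0, 0; 0, 0, a, b * -t; 0, 0, -(t⁻¹ * c), d] := by
  rw [tauRescale_inv ht.ne, tauRescale, abs_of_neg ht]
  ext i j
  rw [Matrix.mul_diagonal, Matrix.diagonal_mul]
  fin_cases i <;> fin_cases j <;> simp [inv_neg]
  field_simp [ht.ne]

/-- As `t → 0⁻`, the rescaled anti-de Sitter rotations `τ_t I_t τ_t⁻¹` of angle `θ t` about the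
spacelike geodesic `x₂ = x₃ = 0` converge to the half-pipe rotation of angle `θ'(0)`. -/
theorem rescaled_adS_rotation_tendsto_halfpipe_rotation
    (θ : ℝ → ℝ) (θ'₀ : ℝ) (hθ : HasDerivAt θ θ'₀ 0) (hθ0 : θ 0 = 0) :
    Tendsto
      (fun t : ℝ =>
        tauRescale t *
          !![1, 0, 0, 0;
             0, 1, 0, 0;
             0, 0, Real.cosh (θ t), Real.sinh (θ t);
             0, 0, Real.sinh (θ t), Real.cosh (θ t)] *
        (tauRescale t)⁻¹)
      (nhdsWithin 0 (Set.Iio 0))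
      (nhds !![1, 0, 0, 0;
               0, 1, 0, 0;
               0, 0, 1, 0;
               0, 0, -θ'₀, 1]) := by
  have hsinh : HasDerivAt (fun t => Real.sinh (θ t)) θ'₀ 0 := by
    simpa [hθ0] using hθ.sinh
  have hslope : Tendsto (fun t => t⁻¹ * Real.sinh (θ t)) (𝓝[<] 0) (𝓝 θ'₀) := by
    simpa [hθ0] using hsinh.tendsto_slope_zero_left
  have hs : Tendsto (fun t => Real.sinh (θ t) * -t) (𝓝[<] 0) (𝓝 0) := by
    have h := (hsinh.continuousAt.fun_mul continuousAt_neg).tendsto.mono_left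
      (nhdsWithin_le_nhds (s := Set.Iio 0))
    simpa using h
  have hc : Tendsto (fun t => Real.cosh (θ t)) (𝓝[<] 0) (𝓝 1) := by
    have h := hθ.cosh.continuousAt.tendsto.mono_left (nhdsWithin_le_nhds (s := Set.Iio 0))
    simpa [hθ0] using h
  refine Tendsto.congr' (eventually_nhdsWithin_of_forall fun t ht =>
    (tauRescale_conj_of_neg ht _ _ _ _).symm) ?_
  refine tendsto_pi_nhds.2 fun i => tendsto_pi_nhds.2 fun j => ?_
  fin_cases i <;> fin_cases j <;>
    first
    | exact tendsto_const_nhds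
    | exact hc
    | exact hs
    | exact hslope.neg
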